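/- Let X be a real Hilbert space, let T : X → X be a compact self-adjoint continuous linear operator, and let (T_n) be a sequence of compact self-adjoint continuous linear operators on X converging pointwise to T and such that the family {T_n} is collectively compact. If μ ≠ 0 is an eigenvalue of T, then for every δ > 0 there exists N such that for all n ≥ N the operator T_n has an eigenvalue μ_n with |μ_n − μ| < δ; in particular one can choose eigenvalues μ_n of T_n with μ_n → μ as n → ∞. -/

import Mathlib

open Filter

open Module End in
/-- If a compact symmetric operator has no eigenvalue at distance less than `δ` from `μ`, then
`T - μ` is bounded below by `δ`. -/
lemma mul_norm_le_norm_apply_sub_smul_of_forall_hasEigenvalue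
    {X : Type*} [NormedAddCommGroup X] [InnerProductSpace ℝ X] [CompleteSpace X]
    {T : X →L[ℝ] X} (hTc : IsCompactOperator T) (hT : T.IsSymmetric) {μ δ : ℝ} (hδ : 0 ≤ δ)
    (h : ∀ ν, HasEigenvalue (T : End ℝ X) ν → δ ≤ |ν - μ|) (x : X) :
    δ * ‖x‖ ≤ ‖T x - μ • x‖ := by
  classical
  have hdense : Dense ((⨆ ν, eigenspace (T : End ℝ X) ν : Submodule ℝ X) : Set X) := by
    rw [Submodule.dense_iff_topologicalClosure_eq_top,
      Submodule.topologicalClosure_eq_top_iff]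
    exact ContinuousLinearMap.orthogonalComplement_iSup_eigenspaces_eq_bot hTc hT
  have hclosed : IsClosed {x : X | δ * ‖x‖ ≤ ‖T x - μ • x‖} :=
    isClosed_le (by fun_prop) (by fun_prop)
  refine hclosed.closure_subset_iff.mpr ?_ (hdense x)
  intro y hy
  obtain ⟨f, rfl⟩ := (Submodule.mem_iSup_iff_exists_dfinsupp' _ y).mp hy
  have hT_apply (ν : ℝ) : T (f ν) = ν • (f ν : X) := mem_eigenspace_iff.mp (f ν).2
  have hsum : T (∑ ν ∈ f.support, (f ν : X)) - μ • ∑ ν ∈ f.support, (f ν : X) =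
      ∑ ν ∈ f.support, (((ν - μ) • f ν : eigenspace (T : End ℝ X) ν) : X) := by
    simp [map_sum, Finset.smul_sum, ← Finset.sum_sub_distrib, hT_apply, sub_smul]
  have hnorm (g : ∀ ν, eigenspace (T : End ℝ X) ν) :
      ‖∑ ν ∈ f.support, (g ν : X)‖ ^ 2 = ∑ ν ∈ f.support, ‖g ν‖ ^ 2 :=
    hT.orthogonalFamily_eigenspaces.norm_sum g f.support
  rw [Set.mem_ofPred_eq, DFinsupp.sum, hsum]
  refine le_of_sq_le_sq ?_ (norm_nonneg _)
  rw [mul_pow, hnorm, hnorm fun ν => (ν - μ) • f ν, Finset.mul_sum]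
  refine Finset.sum_le_sum fun ν hν => ?_
  have hν' : HasEigenvalue (T : End ℝ X) ν := by
    refine hasEigenvalue_of_hasEigenvector (x := (f ν : X)) ⟨(f ν).2, ?_⟩
    simpa using hν
  rw [norm_smul, mul_pow, Real.norm_eq_abs]
  gcongr
  exact h ν hν'

open Module End in
/-- A compact symmetric operator has an eigenvalue near any approximate eigenvalue: the distance
is at most the residual of a normalized approximate eigenvector, up to an arbitrary error. -/
lemma exists_eigenvalue_abs_sub_lt_of_isCompactOperator
    {X : Type*} [NormedAddCommGroup X] [InnerProductSpace ℝ X] [CompleteSpace X]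
    {T : X →L[ℝ] X} (hTc : IsCompactOperator T) (hT : T.IsSymmetric) (μ : ℝ) {x : X} (hx : x ≠ 0)
    {ε : ℝ} (hε : 0 < ε) :
    ∃ ν : ℝ, (∃ y : X, y ≠ 0 ∧ T y = ν • y) ∧ |ν - μ| < ‖T x - μ • x‖ / ‖x‖ + ε := by
  by_contra! hcon
  have hxn : 0 < ‖x‖ := norm_pos_iff.mpr hx
  have hle := mul_norm_le_norm_apply_sub_smul_of_forall_hasEigenvalue hTc hT
    (μ := μ) (δ := ‖T x - μ • x‖ / ‖x‖ + ε) (by positivity) (fun ν hν => by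
      obtain ⟨y, hy⟩ := hν.exists_hasEigenvector
      exact hcon ν ⟨y, hy.2, hy.apply_eq_smul⟩) x
  rw [add_mul, div_mul_cancel₀ _ hxn.ne'] at hle
  nlinarith [mul_pos hε hxn]

/-- Spectral approximation for collectively compact, pointwise convergent sequences of
compact self-adjoint operators on a real Hilbert space: every nonzero eigenvalue `μ` of the
limit operator `T` is approximated by eigenvalues of the operators `Tn n`; in particular,
one can choose eigenvalues `μs n` of `Tn n` (for `n` large) with `μs n → μ`. -/
theorem eigenvalues_of_collectively_compact_pointwise_convergent_approximate
    {X : Type*} [NormedAddCommGroup X] [InnerProductSpace ℝ X] [CompleteSpace X]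
    (T : X →L[ℝ] X) (hTc : IsCompactOperator T) (hTsa : IsSelfAdjoint T)
    (Tn : ℕ → X →L[ℝ] X)
    (hTnc : ∀ n, IsCompactOperator (Tn n)) (hTnsa : ∀ n, IsSelfAdjoint (Tn n))
    (hpt : ∀ x : X, Tendsto (fun n => Tn n x) atTop (nhds (T x)))
    (hcoll : IsCompact (closure (⋃ n : ℕ, (Tn n) '' Metric.closedBall (0 : X) 1)))
    (μ : ℝ) (hμ : μ ≠ 0) (hev : ∃ x : X, x ≠ 0 ∧ T x = μ • x) :
    (∀ δ > (0 : ℝ), ∃ N : ℕ, ∀ n ≥ N,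
      ∃ μn : ℝ, (∃ x : X, x ≠ 0 ∧ Tn n x = μn • x) ∧ |μn - μ| < δ) ∧
    (∃ μs : ℕ → ℝ, Tendsto μs atTop (nhds μ) ∧
      ∀ᶠ n in atTop, ∃ x : X, x ≠ 0 ∧ Tn n x = μs n • x) := by
  obtain ⟨x, hx, hTx⟩ := hev
  choose μs hμs hlt using fun n : ℕ =>
    exists_eigenvalue_abs_sub_lt_of_isCompactOperator (hTnc n) (hTnsa n).isSymmetric μ hx
      (Nat.one_div_pos_of_nat (α := ℝ) (n := n))
  have hbound : Tendsto (fun n : ℕ => ‖Tn n x - μ • x‖ / ‖x‖ + 1 / ((n : ℝ) + 1)) atTop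
      (nhds 0) := by
    simpa [hTx] using ((((hpt x).sub_const (μ • x)).norm).div_const ‖x‖).add
      (tendsto_one_div_add_atTop_nhds_zero_nat (𝕜 := ℝ))
  have hlim : Tendsto μs atTop (nhds μ) := by
    rw [tendsto_iff_dist_tendsto_zero]
    exact squeeze_zero (fun _ => dist_nonneg) (fun n => (hlt n).le) hbound
  refine ⟨fun δ hδ => ?_, μs, hlim, .of_forall hμs⟩
  obtain ⟨N, hN⟩ := Metric.tendsto_atTop.mp hlim δ hδ
  exact ⟨N, fun n hn => ⟨μs n, hμs n, hN n hn⟩⟩
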